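/- The corner locus φ·C of a piecewise smooth function φ: |𝒞| → ℝ on a tropical cycle C = (𝒞,m) of dimension n with smooth weights is itself a tropical cycle with smooth weights of dimension n−1; that is, the subcomplex generated by 𝒞_{n−1} equipped with the corner-locus weight functions satisfies the balancing condition. -/

import Mathlib

open scoped BigOperators

noncomputable section

namespace NonArchDelta

/-- Points of `N_ℝ ≅ ℝ^r`, the real vector space associated to the lattice `N = ℤ^r`. -/
abbrev Pt (r : ℕ) := Fin r → ℝ

variable {r : ℕ}

/-- A vector in `ℝ^r` is a lattice vector if all of its coordinates are integers. -/
def IsLatticeVec (v : Pt r) : Prop := ∀ j, ∃ z : ℤ, v j = (z : ℝ)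

/-- An integral ℝ-affine polyhedron in `ℝ^r`: an intersection of finitely many
half-spaces with integral normal vectors and real constants. -/
def IsIntegralPolyhedron (P : Set (Pt r)) : Prop :=
  ∃ (m : ℕ) (u : Fin m → Fin r → ℤ) (c : Fin m → ℝ),
    P = { x | ∀ i, c i ≤ ∑ j, (u i j : ℝ) * x j }

/-- An integral ℝ-affine polyhedral set: a finite union of integral ℝ-affine polyhedra. -/
def IsPolyhedralSet (P : Set (Pt r)) : Prop :=
  ∃ S : Set (Set (Pt r)), S.Finite ∧ (∀ σ ∈ S, IsIntegralPolyhedron σ) ∧ ⋃₀ S = P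

/-- `τ` is a closed face of the polyhedron `σ`. -/
def IsFaceOf (τ σ : Set (Pt r)) : Prop :=
  τ = σ ∨ ∃ (u : Fin r → ℝ) (c : ℝ),
    (∀ x ∈ σ, c ≤ ∑ j, u j * x j) ∧ τ = σ ∩ { x | ∑ j, u j * x j = c }

/-- The linear space `𝕃_σ` of directions of a polyhedron `σ`. -/
def linSpan (σ : Set (Pt r)) : Submodule ℝ (Pt r) := vectorSpan ℝ σ

/-- The dimension of a polyhedron. -/
def polyDim (σ : Set (Pt r)) : ℕ := Module.finrank ℝ (linSpan σ)

/-- An integral ℝ-affine polyhedral complex in `ℝ^r`. -/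
structure PolyComplex (r : ℕ) where
  /-- the polyhedra of the complex -/
  faces : Set (Set (Pt r))
  finite : faces.Finite
  nonempty : ∀ σ ∈ faces, (σ : Set (Pt r)).Nonempty
  integral : ∀ σ ∈ faces, IsIntegralPolyhedron σ
  face_mem : ∀ σ ∈ faces, ∀ τ : Set (Pt r), IsFaceOf τ σ → τ.Nonempty → τ ∈ faces
  inter_face : ∀ σ ∈ faces, ∀ σ' ∈ faces, (σ ∩ σ' : Set (Pt r)).Nonempty →
    IsFaceOf (σ ∩ σ') σ ∧ IsFaceOf (σ ∩ σ') σ'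

namespace PolyComplex

/-- The support `|𝒞|` of a polyhedral complex. -/
def support (𝒞 : PolyComplex r) : Set (Pt r) := ⋃₀ 𝒞.faces

/-- The cells of dimension `n` of a polyhedral complex. -/
def cells (𝒞 : PolyComplex r) (n : ℕ) : Set (Set (Pt r)) :=
  { σ | σ ∈ 𝒞.faces ∧ polyDim σ = n }

/-- The polyhedral complex has pure dimension `n`: every polyhedron is contained in an
`n`-dimensional one. -/
def PureDim (𝒞 : PolyComplex r) (n : ℕ) : Prop :=
  ∀ σ ∈ 𝒞.faces, ∃ Δ ∈ 𝒞.cells n, σ ⊆ Δ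

end PolyComplex

/-- `g` is a smooth function on an open neighbourhood of `σ` extending `f` from `σ`. -/
def IsSmoothExtension (σ : Set (Pt r)) (f g : Pt r → ℝ) : Prop :=
  ∃ U : Set (Pt r), IsOpen U ∧ σ ⊆ U ∧ ContDiffOn ℝ (⊤ : ℕ∞) g U ∧ ∀ x ∈ σ, g x = f x

/-- `f` is smooth on the polyhedron `σ`:
it is the restriction of a smooth function on a neighbourhood of `σ`. -/
def SmoothOnPoly (σ : Set (Pt r)) (f : Pt r → ℝ) : Prop :=
  ∃ g, IsSmoothExtension σ f g

/-- `φ` is piecewise smooth with polyhedral complex of definition `𝒞`: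
it restricts to a smooth function on every polyhedron of `𝒞`. -/
def PiecewiseSmoothWith (𝒞 : PolyComplex r) (φ : Pt r → ℝ) : Prop :=
  ∀ σ ∈ 𝒞.faces, SmoothOnPoly σ φ

/-- `v` is a lattice vector in `N_σ` representing the generator of the one-dimensional
quotient lattice `N_σ/N_τ` which points from the face `τ` in the direction of `σ`. -/
def IsNormalGen (σ τ : Set (Pt r)) (v : Pt r) : Prop :=
  IsLatticeVec v ∧ v ∈ linSpan σ ∧ v ∉ linSpan τ ∧
  (∀ w : Pt r, IsLatticeVec w → w ∈ linSpan σ →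
    ∃ (k : ℤ) (t : Pt r), IsLatticeVec t ∧ t ∈ linSpan τ ∧ w = (k : ℝ) • v + t) ∧
  ∃ x ∈ τ, ∃ ε : ℝ, 0 < ε ∧ ∀ s : ℝ, 0 ≤ s → s < ε → x + s • v ∈ σ

/-- A tropical cycle of pure dimension `n` with smooth weights in `ℝ^r`:
a weighted integral ℝ-affine polyhedral complex of pure dimension `n` whose smooth
weight functions on the `n`-dimensional cells satisfy the balancing condition in
codimension one. -/
structure TropCycle (r n : ℕ) where
  /-- the underlying polyhedral complex of definition -/
  cx : PolyComplex r
  pure : cx.PureDim n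
  /-- the weight functions on the `n`-dimensional cells -/
  wt : Set (Pt r) → Pt r → ℝ
  wt_smooth : ∀ σ ∈ cx.cells n, SmoothOnPoly σ (wt σ)
  /-- the balancing condition -/
  balanced : ∀ τ ∈ cx.cells (n - 1), ∀ v : Set (Pt r) → Pt r,
    (∀ σ ∈ cx.cells n, IsFaceOf τ σ → IsNormalGen σ τ (v σ)) →
    ∀ ω ∈ τ, (∑ᶠ σ ∈ { σ | σ ∈ cx.cells n ∧ IsFaceOf τ σ }, wt σ ω • v σ) ∈ linSpan τ

/-- A tropical cycle has constant weight functions if each weight function is constant on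
its cell. -/
def TropCycle.ConstantWeights {r n : ℕ} (C : TropCycle r n) : Prop :=
  ∀ σ ∈ C.cx.cells n, ∀ x ∈ σ, ∀ y ∈ σ, C.wt σ x = C.wt σ y


/-- The corner-locus weight function `m_τ` of a piecewise smooth function `φ` on the tropical
cycle `C = (𝒞, m)` of dimension `n`, relative to a choice `v τ σ` of lattice normal vectors
`ω_{σ,τ}` and a choice `g σ` of smooth local extensions of `φ` on the polyhedra of `𝒞`:
`m_τ(ω) = (Σ_{σ ≻ τ} m_σ(ω) · ∂φ_σ/∂ω_{σ,τ}(ω)) − ∂φ_τ/∂ω_τ(ω)` where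
`ω_τ = Σ_{σ ≻ τ} m_σ(ω) · ω_{σ,τ} ∈ 𝕃_τ` and `∂/∂v` is the directional (line) derivative. -/
def cornerWeight {r n : ℕ} (C : TropCycle r n)
    (v : Set (Pt r) → Set (Pt r) → Pt r) (g : Set (Pt r) → Pt r → ℝ)
    (τ : Set (Pt r)) (ω : Pt r) : ℝ :=
  (∑ᶠ σ ∈ { σ | σ ∈ C.cx.cells n ∧ IsFaceOf τ σ }, C.wt σ ω * lineDeriv ℝ (g σ) ω (v τ σ))
    - lineDeriv ℝ (g τ) ω
        (∑ᶠ σ ∈ { σ | σ ∈ C.cx.cells n ∧ IsFaceOf τ σ }, C.wt σ ω • v τ σ)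

theorem aux_convex {P : Set (Pt r)} (h : IsIntegralPolyhedron P) : Convex ℝ P := by
  obtain ⟨m, u, c, rfl⟩ := h
  intro x hx y hy a b ha hb hab i
  have h1 := hx i
  have h2 := hy i
  have : ∑ j, (u i j : ℝ) * (a • x + b • y) j
      = a * ∑ j, (u i j : ℝ) * x j + b * ∑ j, (u i j : ℝ) * y j := by
    rw [Finset.mul_sum, Finset.mul_sum, ← Finset.sum_add_distrib]
    refine Finset.sum_congr rfl fun j _ => ?_
    simp only [Pi.add_apply, Pi.smul_apply, smul_eq_mul]; ring
  rw [this]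
  have : c i = a * c i + b * c i := by rw [← add_mul, hab, one_mul]
  rw [this]
  gcongr

/-- functional with given coefficients -/
def funl (u : Fin r → ℝ) : Pt r →ₗ[ℝ] ℝ := ∑ j, u j • LinearMap.proj j

theorem funl_apply (u : Fin r → ℝ) (x : Pt r) : funl u x = ∑ j, u j * x j := by
  simp [funl]

theorem aux_face {τ σ : Set (Pt r)} (h : IsFaceOf τ σ) (hne : τ ≠ σ) :
    ∃ (f : Pt r →ₗ[ℝ] ℝ) (c : ℝ), (∀ x ∈ σ, c ≤ f x) ∧ (∀ x, x ∈ τ ↔ x ∈ σ ∧ f x = c) := by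
  rcases h with h | ⟨u, c, h1, h2⟩
  · exact absurd h hne
  · refine ⟨funl u, c, fun x hx => ?_, fun x => ?_⟩
    · rw [funl_apply]; exact h1 x hx
    · rw [funl_apply, h2]; rfl

theorem aux_face_sub {τ σ : Set (Pt r)} (h : IsFaceOf τ σ) : τ ⊆ σ := by
  rcases h with h | ⟨u, c, h1, h2⟩
  · exact h.subset
  · rw [h2]; exact Set.inter_subset_left

theorem aux_sub_mem {σ : Set (Pt r)} {x y : Pt r} (hx : x ∈ σ) (hy : y ∈ σ) :
    x - y ∈ linSpan σ := vsub_mem_vectorSpan ℝ hx hy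

theorem aux_lin_mono {τ σ : Set (Pt r)} (h : τ ⊆ σ) : linSpan τ ≤ linSpan σ :=
  vectorSpan_mono ℝ h

/-- a functional constant on `σ` vanishes on `linSpan σ` -/
theorem aux_const {σ : Set (Pt r)} (f : Pt r →ₗ[ℝ] ℝ) (c : ℝ) (h : ∀ x ∈ σ, f x = c)
    {y : Pt r} (hy : y ∈ linSpan σ) : f y = 0 := by
  have : linSpan σ ≤ LinearMap.ker f := by
    unfold linSpan vectorSpan
    rw [Submodule.span_le]
    rintro _ ⟨a, ha, b, hb, rfl⟩
    simp [h a ha, h b hb]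
  exact this hy

theorem aux_face_eq {τ σ : Set (Pt r)} (h : IsFaceOf τ σ) (hn : τ.Nonempty)
    (hL : linSpan σ ≤ linSpan τ) : τ = σ := by
  by_contra hne
  obtain ⟨f, c, h1, h2⟩ := aux_face h hne
  apply hne
  refine subset_antisymm (aux_face_sub h) fun y hy => ?_
  obtain ⟨x, hx⟩ := hn
  have : f (y - x) = 0 := aux_const f c (fun x hx => ((h2 x).1 hx).2)
    (hL (aux_sub_mem hy (aux_face_sub h hx)))
  rw [map_sub, ((h2 x).1 hx).2] at this
  exact (h2 y).2 ⟨hy, by linarith⟩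

theorem aux_decomp {V : Type*} [AddCommGroup V] [Module ℝ V] [FiniteDimensional ℝ V]
    {A B : Submodule ℝ V} (hAB : A ≤ B)
    (hd : Module.finrank ℝ B ≤ Module.finrank ℝ A + 1) {v : V} (hv : v ∈ B) (hvA : v ∉ A)
    {y : V} (hy : y ∈ B) : ∃ b : ℝ, y - b • v ∈ A := by
  have hle : A ⊔ Submodule.span ℝ {v} ≤ B :=
    sup_le hAB (by rw [Submodule.span_singleton_le_iff_mem]; exact hv)
  have hlt : A < A ⊔ Submodule.span ℝ {v} := by
    refine lt_of_le_of_ne le_sup_left fun h => hvA ?_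
    rw [h]
    exact Submodule.mem_sup_right (Submodule.mem_span_singleton_self v)
  have h1 := Submodule.finrank_lt_finrank_of_lt hlt
  have heq := Submodule.eq_of_le_of_finrank_le hle (by omega)
  rw [← heq, Submodule.mem_sup] at hy
  obtain ⟨a, ha, z, hz, rfl⟩ := hy
  obtain ⟨b, rfl⟩ := Submodule.mem_span_singleton.1 hz
  exact ⟨b, by simpa using ha⟩

theorem aux_dir {σ : Set (Pt r)} {f : Pt r →ₗ[ℝ] ℝ} {c : ℝ} (h1 : ∀ x ∈ σ, c ≤ f x)
    {x v : Pt r} (hx : f x = c) {ε : ℝ} (hε : 0 < ε)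
    (h : ∀ s : ℝ, 0 ≤ s → s < ε → x + s • v ∈ σ) : 0 ≤ f v := by
  have := h1 _ (h (ε / 2) (by linarith) (by linarith))
  rw [map_add, map_smul, hx, smul_eq_mul] at this
  by_contra hneg
  push Not at hneg
  nlinarith

/-- lattice decomposition -/
theorem aux_lat {σ τ ρ : Set (Pt r)} {v w y : Pt r} (hv : IsNormalGen σ τ v)
    (hw : IsNormalGen τ ρ w) (hy : IsLatticeVec y) (hyσ : y ∈ linSpan σ) :
    ∃ (k l : ℤ) (s : Pt r), s ∈ linSpan ρ ∧ y = (k : ℝ) • v + (l : ℝ) • w + s := by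
  obtain ⟨k, t, ht, htτ, rfl⟩ := hv.2.2.2.1 y hy hyσ
  obtain ⟨l, s, hs, hsρ, rfl⟩ := hw.2.2.2.1 t ht htτ
  exact ⟨k, l, s, hsρ, by abel⟩

theorem aux_pos_v {σ τ : Set (Pt r)} {v : Pt r} (hv : IsNormalGen σ τ v)
    {f : Pt r →ₗ[ℝ] ℝ} {c : ℝ} (h1 : ∀ x ∈ σ, c ≤ f x)
    (h2 : ∀ x, x ∈ τ ↔ x ∈ σ ∧ f x = c) : 0 < f v := by
  obtain ⟨-, -, hvτ, -, x, hx, ε, hε, hs⟩ := hv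
  refine lt_of_le_of_ne (aux_dir h1 ((h2 x).1 hx).2 hε hs) fun h0 => hvτ ?_
  have hm : x + (ε / 2) • v ∈ τ :=
    (h2 _).2 ⟨hs _ (by linarith) (by linarith), by
      rw [map_add, map_smul, ← h0, ((h2 x).1 hx).2]; simp⟩
  have := aux_sub_mem hm hx
  rw [add_sub_cancel_left] at this
  exact (Submodule.smul_mem_iff _ (by positivity)).1 this

/-- independence -/
theorem aux_indep {σ τ ρ : Set (Pt r)} {v w : Pt r} (hv : IsNormalGen σ τ v)
    (hw : IsNormalGen τ ρ w) (hρτ : ρ ⊆ τ) {a b : ℝ}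
    (h : a • v + b • w ∈ linSpan ρ) : a = 0 ∧ b = 0 := by
  have ha : a = 0 := by
    by_contra ha
    have : a • v ∈ linSpan τ := by
      have := sub_mem (aux_lin_mono hρτ h) (Submodule.smul_mem _ b hw.2.1)
      rwa [add_sub_cancel_right] at this
    exact hv.2.2.1 ((Submodule.smul_mem_iff _ ha).1 this)
  refine ⟨ha, ?_⟩
  by_contra hb
  rw [ha, zero_smul, zero_add] at h
  exact hw.2.2.1 ((Submodule.smul_mem_iff _ hb).1 h)

theorem aux_pair {σ τ τ' ρ : Set (Pt r)} {v w v' w' : Pt r}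
    (hv : IsNormalGen σ τ v) (hw : IsNormalGen τ ρ w)
    (hv' : IsNormalGen σ τ' v') (hw' : IsNormalGen τ' ρ w')
    (hρτ : ρ ⊆ τ) (hτσ : τ ⊆ σ) (hτσ' : τ' ⊆ σ)
    {f f' : Pt r →ₗ[ℝ] ℝ} (hf : ∀ y ∈ linSpan τ, f y = 0) (hf' : ∀ y ∈ linSpan τ', f' y = 0)
    (hρτ' : ρ ⊆ τ')
    (h1 : 0 < f v) (h2 : 0 < f w') (h1' : 0 < f' v') (h2' : 0 < f' w)
    (G : Pt r →ₗ[ℝ] ℝ) (hG : ∀ y ∈ linSpan ρ, G y = 0) :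
    (G v • w - G w • v) + (G v' • w' - G w' • v') ∈ linSpan ρ := by
  obtain ⟨K, A, s1, hs1, e1⟩ := aux_lat hv hw hw'.1 (aux_lin_mono hτσ' hw'.2.1)
  obtain ⟨k, l, s2, hs2, e2⟩ := aux_lat hv hw hv'.1 hv'.2.1
  obtain ⟨K', A', s3, hs3, e3⟩ := aux_lat hv' hw' hw.1 (aux_lin_mono hτσ hw.2.1)
  obtain ⟨k', l', s4, hs4, e4⟩ := aux_lat hv' hw' hv.1 hv.2.1
  have hK : 0 < K := by
    have : f w' = K * f v := by
      conv_lhs => rw [e1]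
      simp [hf w hw.2.1, hf s1 (aux_lin_mono hρτ hs1)]
    rw [this] at h2
    exact_mod_cast pos_of_mul_pos_left h2 h1.le
  have hK' : 0 < K' := by
    have : f' w = K' * f' v' := by
      conv_lhs => rw [e3]
      simp [hf' w' hw'.2.1, hf' s3 (aux_lin_mono hρτ' hs3)]
    rw [this] at h2'
    exact_mod_cast pos_of_mul_pos_left h2' h1'.le
  have r1 : ((K' * k + A' * K : ℝ)) • v + (K' * l + A' * A - 1 : ℝ) • w ∈ linSpan ρ := by
    have : ((K' * k + A' * K : ℝ)) • v + (K' * l + A' * A - 1 : ℝ) • w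
      = -((K' : ℝ) • s2 + (A' : ℝ) • s1 + s3) := by
      have : (K' : ℝ) • ((k : ℝ) • v + (l : ℝ) • w + s2) + (A' : ℝ) • ((K : ℝ) • v + (A : ℝ) • w + s1) + s3 - w = 0 := by
        rw [← e1, ← e2, ← e3, sub_self]
      rw [← sub_eq_zero, ← this]
      module
    rw [this]
    exact neg_mem (add_mem (add_mem (Submodule.smul_mem _ _ hs2) (Submodule.smul_mem _ _ hs1)) hs3)
  have r2 : ((k' * k + l' * K - 1 : ℝ)) • v + (k' * l + l' * A : ℝ) • w ∈ linSpan ρ := by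
    have : ((k' * k + l' * K - 1 : ℝ)) • v + (k' * l + l' * A : ℝ) • w
      = -((k' : ℝ) • s2 + (l' : ℝ) • s1 + s4) := by
      have : (k' : ℝ) • ((k : ℝ) • v + (l : ℝ) • w + s2) + (l' : ℝ) • ((K : ℝ) • v + (A : ℝ) • w + s1) + s4 - v = 0 := by
        rw [← e1, ← e2, ← e4, sub_self]
      rw [← sub_eq_zero, ← this]
      module
    rw [this]
    exact neg_mem (add_mem (add_mem (Submodule.smul_mem _ _ hs2) (Submodule.smul_mem _ _ hs1)) hs4)
  obtain ⟨q1, q2⟩ := aux_indep hv hw hρτ r1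
  obtain ⟨q3, q4⟩ := aux_indep hv hw hρτ r2
  have q1 : K' * k + A' * K = 0 := by exact_mod_cast q1
  have q2 : K' * l + A' * A - 1 = 0 := by exact_mod_cast q2
  have q3 : k' * k + l' * K - 1 = 0 := by exact_mod_cast q3
  have d1 : K' ∣ K := by
    refine ⟨K * l - k * A, ?_⟩
    linear_combination (-K) * q2 + A * q1
  have d2 : K ∣ K' := by
    refine ⟨K' * l' - k' * A', ?_⟩
    linear_combination (-K') * q3 + k' * q1
  have hKK : K = K' := Int.le_antisymm (Int.le_of_dvd hK' d2) (Int.le_of_dvd hK d1)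
  subst hKK
  have q5 : k + A' = 0 := by
    have : K * (k + A') = 0 := by linear_combination q1
    exact (mul_eq_zero.1 this).resolve_left hK.ne'
  have q6 : K * l - k * A = 1 := by linear_combination q2 - A * q5
  have q7 : (K * l - k * A : ℝ) = 1 := by exact_mod_cast q6
  have g1 : G w' = K * G v + A * G w := by
    conv_lhs => rw [e1]
    simp [hG s1 hs1]
  have g2 : G v' = k * G v + l * G w := by
    conv_lhs => rw [e2]
    simp [hG s2 hs2]
  have : (G v • w - G w • v) + (G v' • w' - G w' • v') = G v' • s1 - G w' • s2 := by
    have hl : (K * l : ℝ) = 1 + k * A := by linarith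
    have : G v' • w' - G w' • v' = G v' • ((K : ℝ) • v + (A : ℝ) • w + s1) - G w' • ((k : ℝ) • v + (l : ℝ) • w + s2) := by
      rw [← e1, ← e2]
    rw [this, g1, g2]
    match_scalars
    · linear_combination (-(G v)) * q7
    · linear_combination (G w) * q7
    · ring
    · ring
  rw [this]
  exact sub_mem (Submodule.smul_mem _ _ hs1) (Submodule.smul_mem _ _ hs2)

theorem aux_fderiv {τ σ : Set (Pt r)} {φ g g' : Pt r → ℝ} (hc : Convex ℝ τ) (h : τ ⊆ σ)
    (hg : IsSmoothExtension σ φ g) (hg' : IsSmoothExtension τ φ g') {ω : Pt r} (hω : ω ∈ τ)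
    {y : Pt r} (hy : y ∈ linSpan τ) : fderiv ℝ g ω y = fderiv ℝ g' ω y := by
  obtain ⟨U, hU, hσU, hgU, hge⟩ := hg
  obtain ⟨U', hU', hσU', hgU', hge'⟩ := hg'
  have d : DifferentiableAt ℝ g ω :=
    (hgU.differentiableOn (by simp)).differentiableAt (hU.mem_nhds (hσU (h hω)))
  have d' : DifferentiableAt ℝ g' ω :=
    (hgU'.differentiableOn (by simp)).differentiableAt (hU'.mem_nhds (hσU' hω))
  have a := d.hasFDerivAt.hasFDerivWithinAt (s := τ)
  have b := d'.hasFDerivAt.hasFDerivWithinAt (s := τ)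
  have a' := a.congr (f₁ := φ) (fun x hx => (hge x (h hx)).symm) (hge ω (h hω)).symm
  have b' := b.congr (f₁ := φ) (fun x hx => (hge' x hx).symm) (hge' ω hω).symm
  have key := a'.unique_on b'
  have : linSpan τ ≤ LinearMap.eqLocus (fderiv ℝ g ω).toLinearMap (fderiv ℝ g' ω).toLinearMap := by
    unfold linSpan
    rw [vectorSpan_eq_span_vsub_set_right ℝ hω, Submodule.span_le]
    rintro _ ⟨z, hz, rfl⟩
    exact key (mem_tangentConeAt_of_segment_subset (hc.segment_subset hω hz))
  exact this hy

theorem aux_relint {m : ℕ} (f : Fin m → Pt r →ₗ[ℝ] ℝ) (c : Fin m → ℝ) {ρ : Set (Pt r)}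
    (hc : Convex ℝ ρ) (hn : ρ.Nonempty) (h : ∀ x ∈ ρ, ∀ i, c i ≤ f i x) (S : Finset (Fin m)) :
    ∃ p ∈ ρ, ∀ i ∈ S, f i p = c i → ∀ y ∈ ρ, f i y = c i := by
  classical
  induction S using Finset.induction_on with
  | empty => obtain ⟨p, hp⟩ := hn; exact ⟨p, hp, by simp⟩
  | insert i S hi ih =>
    obtain ⟨p, hp, hpS⟩ := ih
    by_cases hconst : ∀ y ∈ ρ, f i y = c i
    · refine ⟨p, hp, fun j hj => ?_⟩
      rcases Finset.mem_insert.1 hj with rfl | hj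
      · exact fun _ => hconst
      · exact hpS j hj
    · push Not at hconst
      obtain ⟨z, hz, hzi⟩ := hconst
      have hval : ∀ j, f j ((1/2 : ℝ) • p + (1/2 : ℝ) • z) = 1/2 * f j p + 1/2 * f j z := by
        intro j; simp
      refine ⟨(1/2 : ℝ) • p + (1/2 : ℝ) • z, hc hp hz (by norm_num) (by norm_num) (by norm_num), ?_⟩
      intro j hj hjc
      rw [hval] at hjc
      have e1 := h p hp j
      have e2 := h z hz j
      rcases Finset.mem_insert.1 hj with rfl | hj
      · exact absurd (by linarith) hzi
      · exact hpS j hj (by linarith)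

theorem aux_sub_face (X : PolyComplex r) {τ σ : Set (Pt r)} (hτ : τ ∈ X.faces) (hσ : σ ∈ X.faces)
    (h : τ ⊆ σ) : IsFaceOf τ σ := by
  have e : τ ∩ σ = τ := Set.inter_eq_left.2 h
  have := (X.inter_face τ hτ σ hσ (by rw [e]; exact X.nonempty τ hτ)).2
  rwa [e] at this

theorem aux_pos_w (X : PolyComplex r) {ρ τ τ' σ : Set (Pt r)} {k : ℕ}
    (hτ : τ ∈ X.cells (k + 1)) (hτ' : τ' ∈ X.cells (k + 1)) (hρ : ρ ∈ X.cells k)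
    (hρτ : ρ ⊆ τ) (hρτ' : ρ ⊆ τ') (hτσ' : τ' ⊆ σ) (hne : τ ≠ τ')
    {w' : Pt r} (hw' : IsNormalGen τ' ρ w')
    {f : Pt r →ₗ[ℝ] ℝ} {c : ℝ} (h1 : ∀ x ∈ σ, c ≤ f x)
    (h2 : ∀ x, x ∈ τ ↔ x ∈ σ ∧ f x = c) : 0 < f w' := by
  obtain ⟨-, hwτ', hwρ, -, x, hx, ε, hε, hs⟩ := hw'
  have hfx := ((h2 x).1 (hρτ hx)).2
  refine lt_of_le_of_ne (aux_dir h1 hfx hε (fun s a b => hτσ' (hs s a b))) fun h0 => hne ?_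
  have hm : x + (ε / 2) • w' ∈ τ :=
    (h2 _).2 ⟨hτσ' (hs _ (by linarith) (by linarith)), by
      rw [map_add, map_smul, ← h0, hfx]; simp⟩
  have hwτ := aux_sub_mem hm (hρτ hx)
  rw [add_sub_cancel_left] at hwτ
  have hwτ := (Submodule.smul_mem_iff _ (by positivity)).1 hwτ
  have hle : linSpan τ' ≤ linSpan τ := by
    intro y hy
    obtain ⟨b, hb⟩ := aux_decomp (aux_lin_mono hρτ')
      (by have a := hτ'.2; have b := hρ.2; unfold polyDim at a b; omega) hwτ' hwρ hy
    have := add_mem (aux_lin_mono hρτ hb) (Submodule.smul_mem _ b hwτ)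
    rwa [sub_add_cancel] at this
  have heq : linSpan τ' = linSpan τ := Submodule.eq_of_le_of_finrank_le hle
      (by have a := hτ'.2; have b := hτ.2; unfold polyDim at a b; omega)
  have hsub : τ' ⊆ τ := by
    intro y hy
    have := aux_const f c (fun x hx => ((h2 x).1 hx).2) (hle (aux_sub_mem hy (hρτ' hx)))
    rw [map_sub, hfx] at this
    exact (h2 y).2 ⟨hτσ' hy, by linarith⟩
  exact (aux_face_eq (aux_sub_face X hτ'.1 hτ.1 hsub) (X.nonempty _ hτ'.1) heq.ge).symm

theorem aux_ne_of_dim {τ σ : Set (Pt r)} {k l : ℕ} (X : PolyComplex r) (h : τ ∈ X.cells k)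
    (h' : σ ∈ X.cells l) (hkl : k ≠ l) : τ ≠ σ := by
  rintro rfl
  exact hkl (h.2.symm.trans h'.2)

theorem aux_step {m : ℕ} (f : Fin m → Pt r →ₗ[ℝ] ℝ) (c : Fin m → ℝ) {p y : Pt r}
    (hp : ∀ i, c i ≤ f i p) (hy : ∀ i, f i p = c i → 0 ≤ f i y) :
    ∃ ε : ℝ, 0 < ε ∧ ∀ i, c i ≤ f i (p + ε • y) := by
  have : ∀ᶠ s : ℝ in nhdsWithin 0 (Set.Ioi 0), 0 < s ∧ ∀ i, c i ≤ f i (p + s • y) := by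
    refine (eventually_mem_nhdsWithin).and (Filter.eventually_all.2 fun i => ?_)
    by_cases hi : f i p = c i
    · filter_upwards [self_mem_nhdsWithin] with s hs
      have := mul_nonneg (le_of_lt (Set.mem_Ioi.1 hs)) (hy i hi)
      simp only [map_add, map_smul, smul_eq_mul]
      linarith
    · have hlt : c i < f i p := lt_of_le_of_ne (hp i) (Ne.symm hi)
      have hcont : Continuous fun s : ℝ => f i p + s * f i y := by fun_prop
      have := (hcont.tendsto' 0 (f i p) (by simp)).eventually_const_lt hlt
      filter_upwards [nhdsWithin_le_nhds this] with s hs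
      simp only [map_add, map_smul, smul_eq_mul]
      exact hs.le
  exact this.exists

theorem aux_exists (X : PolyComplex r) {ρ τ σ : Set (Pt r)} {k : ℕ}
    (hσ : σ ∈ X.cells (k + 2)) (hτ : τ ∈ X.cells (k + 1)) (hρ : ρ ∈ X.cells k)
    (hρτ : ρ ⊆ τ) (hτσ : τ ⊆ σ) {v w : Pt r} (hv : IsNormalGen σ τ v)
    (hw : IsNormalGen τ ρ w) :
    ∃ τ' ∈ X.cells (k + 1), ρ ⊆ τ' ∧ τ' ⊆ σ ∧ τ ≠ τ' := by
  classical
  obtain ⟨m, u, c, hσeq⟩ := X.integral σ hσ.1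
  obtain ⟨f1, c1, h11, h12⟩ := aux_face (aux_sub_face X hτ.1 hσ.1 hτσ)
    (aux_ne_of_dim X hτ hσ (by omega))
  obtain ⟨f0, c0, h01, h02⟩ := aux_face (aux_sub_face X hρ.1 hτ.1 hρτ)
    (aux_ne_of_dim X hρ hτ (by omega))
  set f : Fin m → Pt r →ₗ[ℝ] ℝ := fun i => funl (fun j => (u i j : ℝ)) with hf
  have hmem : ∀ x, x ∈ σ ↔ ∀ i, c i ≤ f i x := by
    intro x
    simp only [hf, funl_apply]
    rw [hσeq]; rfl
  have hρσ : ρ ⊆ σ := hρτ.trans hτσ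
  obtain ⟨p, hp, hpc⟩ := aux_relint f c (aux_convex (X.integral ρ hρ.1)) (X.nonempty ρ hρ.1)
    (fun x hx => (hmem x).1 (hρσ hx)) Finset.univ
  have hpc : ∀ i, f i p = c i → ∀ y ∈ ρ, f i y = c i := fun i => hpc i (Finset.mem_univ i)
  have hα : ∀ i, f i p = c i → 0 ≤ f i w := by
    intro i hi
    obtain ⟨x, hx, ε, hε, hs⟩ := hw.2.2.2.2
    exact aux_dir (σ := σ) (fun x hx => (hmem x).1 hx i) (hpc i hi x hx) hε
      (fun s a b => hτσ (hs s a b))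
  have hβ : ∀ i, f i p = c i → f i w = 0 → 0 ≤ f i v := by
    intro i hi hiw
    obtain ⟨x, hx, ε, hε, hs⟩ := hv.2.2.2.2
    obtain ⟨b, hb⟩ := aux_decomp (aux_lin_mono hρτ)
      (by have a := hτ.2; have b := hρ.2; unfold polyDim at a b; omega) hw.2.1 hw.2.2.1
      (aux_sub_mem hx (hρτ hp))
    have e := aux_const (f i) (c i) (hpc i hi) hb
    have e2 := (hmem _).1 (hs (ε / 2) (by linarith) (by linarith)) i
    simp only [map_add, map_sub, map_smul, smul_eq_mul, hiw, hi] at e e2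
    by_contra hneg
    push Not at hneg
    nlinarith
  have hf0w : 0 < f0 w := aux_pos_v hw h01 h02
  have hI : (Finset.univ.filter fun i => f i p = c i ∧ 0 < f i w).Nonempty := by
    by_contra hemp
    rw [Finset.not_nonempty_iff_eq_empty, Finset.filter_eq_empty_iff] at hemp
    obtain ⟨ε, hε, hstep⟩ := aux_step f c (p := p) (y := -w) ((hmem p).1 (hρσ hp)) (by
      intro i hi
      have := hemp (Finset.mem_univ i)
      push Not at this
      rw [map_neg]
      linarith [this hi])
    have hqσ := (hmem _).2 hstep
    have hqτ : p + ε • -w ∈ τ := by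
      refine (h12 _).2 ⟨hqσ, ?_⟩
      have := aux_const f1 c1 (fun x hx => ((h12 x).1 hx).2) hw.2.1
      rw [map_add, map_smul, map_neg, this, ((h12 p).1 (hρτ hp)).2]
      simp
    have := h01 _ hqτ
    rw [map_add, map_smul, map_neg, ((h02 p).1 hp).2, smul_eq_mul] at this
    nlinarith
  obtain ⟨i₀, hi₀, hmax⟩ := Finset.exists_max_image _ (fun i => - f i v / f i w) hI
  obtain ⟨-, hi₀p, hi₀w⟩ := Finset.mem_filter.1 hi₀
  set a : ℝ := - f i₀ v / f i₀ w with ha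
  have ha0 : f i₀ v + a * f i₀ w = 0 := by
    rw [ha]; field_simp; ring
  obtain ⟨ε, hε, hstep⟩ := aux_step f c (p := p) (y := v + a • w) ((hmem p).1 (hρσ hp)) (by
    intro i hi
    rw [map_add, map_smul, smul_eq_mul]
    rcases (hα i hi).eq_or_lt with h0 | h0
    · rw [← h0, mul_zero, add_zero]; exact hβ i hi h0.symm
    · have := hmax i (Finset.mem_filter.2 ⟨Finset.mem_univ i, hi, h0⟩)
      rw [div_le_iff₀ h0] at this
      linarith)
  have hqσ := (hmem _).2 hstep
  set τ' : Set (Pt r) := σ ∩ {x | ∑ j, (u i₀ j : ℝ) * x j = c i₀} with hτ'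
  have hmem' : ∀ x, x ∈ τ' ↔ x ∈ σ ∧ f i₀ x = c i₀ := by
    intro x
    simp only [hf, funl_apply]
    rfl
  have hface : IsFaceOf τ' σ := by
    refine Or.inr ⟨fun j => (u i₀ j : ℝ), c i₀, fun x hx => ?_, rfl⟩
    have := (hmem x).1 hx i₀
    simpa only [hf, funl_apply] using this
  have hρτ' : ρ ⊆ τ' := fun x hx => (hmem' x).2 ⟨hρσ hx, hpc i₀ hi₀p x hx⟩
  have hτ'X : τ' ∈ X.faces := X.face_mem σ hσ.1 τ' hface ⟨p, hρτ' hp⟩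
  have hτ'σ : τ' ⊆ σ := aux_face_sub hface
  have hq : p + ε • (v + a • w) ∈ τ' := by
    refine (hmem' _).2 ⟨hqσ, ?_⟩
    simp only [map_add, map_smul, smul_eq_mul, ha0, hi₀p]
    simp
  have hw2 : v + a • w ∈ linSpan τ' := by
    have := aux_sub_mem hq (hρτ' hp)
    rw [add_sub_cancel_left] at this
    exact (Submodule.smul_mem_iff _ hε.ne').1 this
  have hw2ρ : v + a • w ∉ linSpan ρ := by
    intro h
    have := aux_indep hv hw hρτ (a := 1) (b := a) (by rwa [one_smul])
    exact one_ne_zero this.1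
  have hwτ' : w ∉ linSpan τ' := fun h =>
    hi₀w.ne' (aux_const (f i₀) (c i₀) (fun x hx => ((hmem' x).1 hx).2) h)
  have l1 : linSpan ρ < linSpan τ' := lt_of_le_of_ne (aux_lin_mono hρτ') fun h =>
    hw2ρ (by rw [h]; exact hw2)
  have l2 : linSpan τ' < linSpan σ := lt_of_le_of_ne (aux_lin_mono hτ'σ) fun h =>
    hwτ' (by rw [h]; exact aux_lin_mono hτσ hw.2.1)
  have d1 := Submodule.finrank_lt_finrank_of_lt l1
  have d2 := Submodule.finrank_lt_finrank_of_lt l2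
  refine ⟨τ', ⟨hτ'X, ?_⟩, hρτ', hτ'σ, ?_⟩
  · have a := hσ.2
    have b := hρ.2
    unfold polyDim at a b ⊢
    omega
  · intro h
    exact hwτ' (by rw [← h]; exact hw.2.1)

theorem aux_three (X : PolyComplex r) {ρ τ1 τ2 τ3 σ : Set (Pt r)} {k : ℕ}
    (hσ : σ ∈ X.cells (k + 2)) (hρ : ρ ∈ X.cells k)
    (h1 : τ1 ∈ X.cells (k + 1)) (h2 : τ2 ∈ X.cells (k + 1)) (h3 : τ3 ∈ X.cells (k + 1))
    (r1 : ρ ⊆ τ1) (r2 : ρ ⊆ τ2) (r3 : ρ ⊆ τ3) (s1 : τ1 ⊆ σ) (s2 : τ2 ⊆ σ) (s3 : τ3 ⊆ σ)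
    {w1 w2 w3 : Pt r} (hw1 : IsNormalGen τ1 ρ w1) (hw2 : IsNormalGen τ2 ρ w2)
    (hw3 : IsNormalGen τ3 ρ w3) (n12 : τ1 ≠ τ2) (n13 : τ1 ≠ τ3) (n23 : τ2 ≠ τ3) : False := by
  obtain ⟨f1, c1, a1, b1⟩ := aux_face (aux_sub_face X h1.1 hσ.1 s1)
    (aux_ne_of_dim X h1 hσ (by omega))
  obtain ⟨f2, c2, a2, b2⟩ := aux_face (aux_sub_face X h2.1 hσ.1 s2)
    (aux_ne_of_dim X h2 hσ (by omega))
  obtain ⟨f3, c3, a3, b3⟩ := aux_face (aux_sub_face X h3.1 hσ.1 s3)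
    (aux_ne_of_dim X h3 hσ (by omega))
  have p12 := aux_pos_w X h1 h2 hρ r1 r2 s2 n12 hw2 a1 b1
  have p13 := aux_pos_w X h1 h3 hρ r1 r3 s3 n13 hw3 a1 b1
  have p21 := aux_pos_w X h2 h1 hρ r2 r1 s1 n12.symm hw1 a2 b2
  have p23 := aux_pos_w X h2 h3 hρ r2 r3 s3 n23 hw3 a2 b2
  have p31 := aux_pos_w X h3 h1 hρ r3 r1 s1 n13.symm hw1 a3 b3
  have p32 := aux_pos_w X h3 h2 hρ r3 r2 s2 n23.symm hw2 a3 b3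
  have z1 : ∀ y ∈ linSpan τ1, f1 y = 0 := fun y hy =>
    aux_const f1 c1 (fun x hx => ((b1 x).1 hx).2) hy
  have z2 : ∀ y ∈ linSpan τ2, f2 y = 0 := fun y hy =>
    aux_const f2 c2 (fun x hx => ((b2 x).1 hx).2) hy
  have z3 : ∀ y ∈ linSpan τ3, f3 y = 0 := fun y hy =>
    aux_const f3 c3 (fun x hx => ((b3 x).1 hx).2) hy
  have dσ := hσ.2
  have d1 := h1.2
  have dρ := hρ.2
  unfold polyDim at dσ d1 dρ
  obtain ⟨b, hb⟩ := aux_decomp (aux_lin_mono s1) (by omega) (aux_lin_mono s2 hw2.2.1)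
    (fun h => p12.ne' (z1 _ h)) (aux_lin_mono s3 hw3.2.1)
  obtain ⟨a, ha⟩ := aux_decomp (aux_lin_mono r1) (by omega) hw1.2.1 hw1.2.2.1 hb
  have e1 := z1 _ (aux_lin_mono r1 ha)
  have e2 := z2 _ (aux_lin_mono r2 ha)
  have e3 := z3 _ (aux_lin_mono r3 ha)
  simp only [map_sub, map_smul, smul_eq_mul, z1 _ hw1.2.1, z2 _ hw2.2.1, z3 _ hw3.2.1] at e1 e2 e3
  have hb : 0 < b := by
    have : 0 < b * f1 w2 := by linarith
    exact pos_of_mul_pos_left this p12.le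
  have ha : 0 < a := by
    have : 0 < a * f2 w1 := by linarith
    exact pos_of_mul_pos_left this p21.le
  have := mul_pos hb p32
  have := mul_pos ha p31
  linarith

theorem aux_sigma (X : PolyComplex r) {ρ σ : Set (Pt r)} {k : ℕ}
    (hσ : σ ∈ X.cells (k + 2)) (hρ : ρ ∈ X.cells k) (S : Finset (Set (Pt r)))
    (hS : ∀ τ, τ ∈ S ↔ τ ∈ X.cells (k + 1) ∧ ρ ⊆ τ ∧ τ ⊆ σ)
    (v w : Set (Pt r) → Pt r) (hv : ∀ τ ∈ S, IsNormalGen σ τ (v τ))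
    (hw : ∀ τ ∈ S, IsNormalGen τ ρ (w τ))
    (G : Pt r →ₗ[ℝ] ℝ) (hG : ∀ y ∈ linSpan ρ, G y = 0) :
    ∑ τ ∈ S, (G (v τ) • w τ - G (w τ) • v τ) ∈ linSpan ρ := by
  classical
  rcases S.eq_empty_or_nonempty with rfl | ⟨τ1, m1⟩
  · simp
  obtain ⟨h1, r1, s1⟩ := (hS τ1).1 m1
  obtain ⟨τ2, h2, r2, s2, n12⟩ := aux_exists X hσ h1 hρ r1 s1 (hv _ m1) (hw _ m1)
  have m2 := (hS τ2).2 ⟨h2, r2, s2⟩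
  have hSe : S = {τ1, τ2} := by
    ext τ3
    rw [Finset.mem_insert, Finset.mem_singleton]
    constructor
    · intro m3
      obtain ⟨h3, r3, s3⟩ := (hS τ3).1 m3
      by_contra hcon
      push Not at hcon
      exact aux_three X hσ hρ h1 h2 h3 r1 r2 r3 s1 s2 s3 (hw _ m1) (hw _ m2) (hw _ m3)
        n12 hcon.1.symm hcon.2.symm
    · rintro (rfl | rfl)
      · exact m1
      · exact m2
  rw [hSe, Finset.sum_pair n12]
  obtain ⟨f1, c1, a1, b1⟩ := aux_face (aux_sub_face X h1.1 hσ.1 s1)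
    (aux_ne_of_dim X h1 hσ (by omega))
  obtain ⟨f2, c2, a2, b2⟩ := aux_face (aux_sub_face X h2.1 hσ.1 s2)
    (aux_ne_of_dim X h2 hσ (by omega))
  exact aux_pair (hv _ m1) (hw _ m1) (hv _ m2) (hw _ m2) r1 s1 s2
    (fun y hy => aux_const f1 c1 (fun x hx => ((b1 x).1 hx).2) hy)
    (fun y hy => aux_const f2 c2 (fun x hx => ((b2 x).1 hx).2) hy) r2
    (aux_pos_v (hv _ m1) a1 b1) (aux_pos_w X h1 h2 hρ r1 r2 s2 n12 (hw _ m2) a1 b1)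
    (aux_pos_v (hv _ m2) a2 b2) (aux_pos_w X h2 h1 hρ r2 r1 s1 n12.symm (hw _ m1) a2 b2) G hG

theorem aux_smooth_mono {τ σ : Set (Pt r)} {f : Pt r → ℝ} (h : τ ⊆ σ) (hf : SmoothOnPoly σ f) :
    SmoothOnPoly τ f := by
  obtain ⟨g, U, hU, hs, hg, he⟩ := hf
  exact ⟨g, U, hU, h.trans hs, hg, fun x hx => he x (h hx)⟩

theorem aux_smooth_congr {τ : Set (Pt r)} {f f' : Pt r → ℝ} (hf : SmoothOnPoly τ f)
    (h : ∀ x ∈ τ, f x = f' x) : SmoothOnPoly τ f' := by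
  obtain ⟨g, U, hU, hs, hg, he⟩ := hf
  exact ⟨g, U, hU, hs, hg, fun x hx => (he x hx).trans (h x hx)⟩

theorem aux_smooth_mul {τ : Set (Pt r)} {f f' : Pt r → ℝ} (hf : SmoothOnPoly τ f)
    (hf' : SmoothOnPoly τ f') : SmoothOnPoly τ (fun x => f x * f' x) := by
  obtain ⟨g, U, hU, hs, hg, he⟩ := hf
  obtain ⟨g', U', hU', hs', hg', he'⟩ := hf'
  refine ⟨fun x => g x * g' x, U ∩ U', hU.inter hU', Set.subset_inter hs hs',
    (hg.mono Set.inter_subset_left).mul (hg'.mono Set.inter_subset_right), fun x hx => ?_⟩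
  simp only [he x hx, he' x hx]

theorem aux_smooth_sub {τ : Set (Pt r)} {f f' : Pt r → ℝ} (hf : SmoothOnPoly τ f)
    (hf' : SmoothOnPoly τ f') : SmoothOnPoly τ (fun x => f x - f' x) := by
  obtain ⟨g, U, hU, hs, hg, he⟩ := hf
  obtain ⟨g', U', hU', hs', hg', he'⟩ := hf'
  refine ⟨fun x => g x - g' x, U ∩ U', hU.inter hU', Set.subset_inter hs hs',
    (hg.mono Set.inter_subset_left).sub (hg'.mono Set.inter_subset_right), fun x hx => ?_⟩
  simp only [he x hx, he' x hx]

theorem aux_smooth_add {τ : Set (Pt r)} {f f' : Pt r → ℝ} (hf : SmoothOnPoly τ f)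
    (hf' : SmoothOnPoly τ f') : SmoothOnPoly τ (fun x => f x + f' x) := by
  obtain ⟨g, U, hU, hs, hg, he⟩ := hf
  obtain ⟨g', U', hU', hs', hg', he'⟩ := hf'
  refine ⟨fun x => g x + g' x, U ∩ U', hU.inter hU', Set.subset_inter hs hs',
    (hg.mono Set.inter_subset_left).add (hg'.mono Set.inter_subset_right), fun x hx => ?_⟩
  simp only [he x hx, he' x hx]

theorem aux_smooth_sum {ι : Type*} {τ : Set (Pt r)} (S : Finset ι) (f : ι → Pt r → ℝ)
    (hf : ∀ i ∈ S, SmoothOnPoly τ (f i)) : SmoothOnPoly τ (fun x => ∑ i ∈ S, f i x) := by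
  classical
  induction S using Finset.induction_on with
  | empty => exact ⟨fun _ => 0, Set.univ, isOpen_univ, Set.subset_univ _, contDiffOn_const, by simp⟩
  | insert i S hi ih =>
    refine aux_smooth_congr (aux_smooth_add (hf i (Finset.mem_insert_self i S))
      (ih fun j hj => hf j (Finset.mem_insert_of_mem hj))) fun x _ => ?_
    rw [Finset.sum_insert hi]

theorem aux_smooth_fderiv {σ : Set (Pt r)} {φ g : Pt r → ℝ} (hg : IsSmoothExtension σ φ g)
    (v : Pt r) : SmoothOnPoly σ (fun x => fderiv ℝ g x v) := by
  obtain ⟨U, hU, hs, hg, he⟩ := hg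
  refine ⟨fun x => fderiv ℝ g x v, U, hU, hs, ?_, fun x _ => rfl⟩
  exact (hg.fderiv_of_isOpen hU (by simp)).clm_apply contDiffOn_const

theorem aux_diff {σ : Set (Pt r)} {φ g : Pt r → ℝ} (hg : IsSmoothExtension σ φ g)
    {ω : Pt r} (hω : ω ∈ σ) : DifferentiableAt ℝ g ω := by
  obtain ⟨U, hU, hs, hg, he⟩ := hg
  exact (hg.differentiableOn (by simp)).differentiableAt (hU.mem_nhds (hs hω))

theorem aux_corner {n : ℕ} (C : TropCycle r n) (φ : Pt r → ℝ)
    (v : Set (Pt r) → Set (Pt r) → Pt r) (g : Set (Pt r) → Pt r → ℝ)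
    (hg : ∀ σ ∈ C.cx.faces, IsSmoothExtension σ φ (g σ)) {τ : Set (Pt r)} (hτ : τ ∈ C.cx.faces)
    (S : Finset (Set (Pt r))) (hS : ∀ σ, σ ∈ S ↔ σ ∈ C.cx.cells n ∧ IsFaceOf τ σ)
    {ω : Pt r} (hω : ω ∈ τ) :
    cornerWeight C v g τ ω = (∑ σ ∈ S, C.wt σ ω * fderiv ℝ (g σ) ω (v τ σ))
      - fderiv ℝ (g τ) ω (∑ σ ∈ S, C.wt σ ω • v τ σ) := by
  have hSs : { σ | σ ∈ C.cx.cells n ∧ IsFaceOf τ σ } = (S : Set (Set (Pt r))) := by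
    ext σ; rw [Finset.mem_coe, hS]; rfl
  unfold cornerWeight
  rw [hSs, finsum_mem_coe_finset, finsum_mem_coe_finset,
    (aux_diff (hg τ hτ) hω).lineDeriv_eq_fderiv]
  congr 1
  refine Finset.sum_congr rfl fun σ hσ => ?_
  obtain ⟨a, b⟩ := (hS σ).1 hσ
  rw [(aux_diff (hg σ a.1) (aux_face_sub b hω)).lineDeriv_eq_fderiv]

theorem aux_main {k : ℕ} (C : TropCycle r (k + 2)) (φ : Pt r → ℝ)
    (v : Set (Pt r) → Set (Pt r) → Pt r)
    (hv : ∀ τ ∈ C.cx.cells (k + 1), ∀ σ ∈ C.cx.cells (k + 2),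
      IsFaceOf τ σ → IsNormalGen σ τ (v τ σ))
    (g : Set (Pt r) → Pt r → ℝ)
    (hg : ∀ σ ∈ C.cx.faces, IsSmoothExtension σ φ (g σ))
    (ρ : Set (Pt r)) (hρ : ρ ∈ C.cx.cells k) (w : Set (Pt r) → Pt r)
    (hw : ∀ τ ∈ C.cx.cells (k + 1), IsFaceOf ρ τ → IsNormalGen τ ρ (w τ))
    (ω : Pt r) (hω : ω ∈ ρ) :
    (∑ᶠ τ ∈ { τ | τ ∈ C.cx.cells (k + 1) ∧ IsFaceOf ρ τ },
            cornerWeight C v g τ ω • w τ) ∈ linSpan ρ := by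
  classical
  set X := C.cx with hX
  have hfin : ∀ n, (X.cells n).Finite := fun n => X.finite.subset fun σ h => h.1
  let A : Finset (Set (Pt r)) := (hfin (k + 2)).toFinset
  let B : Finset (Set (Pt r)) := (hfin (k + 1)).toFinset
  have hA : ∀ σ, σ ∈ A ↔ σ ∈ X.cells (k + 2) := fun σ => Set.Finite.mem_toFinset _
  have hB : ∀ σ, σ ∈ B ↔ σ ∈ X.cells (k + 1) := fun σ => Set.Finite.mem_toFinset _
  have hBs : { τ | τ ∈ X.cells (k + 1) ∧ IsFaceOf ρ τ }
      = ((B.filter fun τ => IsFaceOf ρ τ : Finset _) : Set (Set (Pt r))) := by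
    ext τ; rw [Finset.mem_coe, Finset.mem_filter, hB]; rfl
  rw [hBs, finsum_mem_coe_finset]
  let F : Set (Pt r) → Pt r →ₗ[ℝ] ℝ := fun σ => (fderiv ℝ (g σ) ω).toLinearMap
  have hF : ∀ σ y, fderiv ℝ (g σ) ω y = F σ y := fun _ _ => rfl
  let E : Set (Pt r) → Set (Pt r) → Pt r := fun τ σ =>
    C.wt σ ω • ((F σ - F ρ) (v τ σ) • w τ - (F σ - F ρ) (w τ) • v τ σ)
  have hagree : ∀ τ ∈ X.faces, ∀ σ ∈ X.faces, τ ⊆ σ → ω ∈ τ → ∀ y ∈ linSpan τ, F σ y = F τ y := by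
    intro τ hτ σ hσ hs hωτ y hy
    exact aux_fderiv (aux_convex (X.integral τ hτ)) hs (hg σ hσ) (hg τ hτ) hωτ hy
  have hper : ∀ τ ∈ B.filter (fun τ => IsFaceOf ρ τ),
      cornerWeight C v g τ ω • w τ - ∑ σ ∈ A.filter (fun σ => IsFaceOf τ σ), E τ σ
        ∈ linSpan ρ := by
    intro τ hτ
    obtain ⟨hτB, hρτ⟩ := Finset.mem_filter.1 hτ
    have hτc := (hB τ).1 hτB
    have hωτ := aux_face_sub hρτ hω
    have hS : ∀ σ, σ ∈ A.filter (fun σ => IsFaceOf τ σ) ↔ σ ∈ X.cells (k + 2) ∧ IsFaceOf τ σ := by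
      intro σ; rw [Finset.mem_filter, hA]
    have hwτ := hw τ hτc hρτ
    have hbal := C.balanced τ hτc (v τ) (hv τ hτc) ω hωτ
    have hSs : { σ | σ ∈ C.cx.cells (k + 2) ∧ IsFaceOf τ σ }
        = ((A.filter fun σ => IsFaceOf τ σ : Finset _) : Set (Set (Pt r))) := by
      ext σ; rw [Finset.mem_coe, hS]; rfl
    rw [hSs, finsum_mem_coe_finset] at hbal
    rw [aux_corner C φ v g hg hτc.1 _ hS hωτ]
    set S := A.filter fun σ => IsFaceOf τ σ with hSdef
    set y := ∑ σ ∈ S, C.wt σ ω • v τ σ with hy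
    obtain ⟨b, hb⟩ := aux_decomp (aux_lin_mono (aux_face_sub hρτ))
      (by have a := hτc.2; have b := hρ.2; unfold polyDim at a b; omega) hwτ.2.1 hwτ.2.2.1 hbal
    have hE : ∑ σ ∈ S, E τ σ = (∑ σ ∈ S, C.wt σ ω * F σ (v τ σ)) • w τ - (F ρ y) • w τ
        - (F τ - F ρ) (w τ) • y := by
      rw [hy, map_sum, Finset.sum_smul, Finset.sum_smul, Finset.smul_sum,
        ← Finset.sum_sub_distrib, ← Finset.sum_sub_distrib]
      refine Finset.sum_congr rfl fun σ hσ => ?_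
      obtain ⟨h1, h2⟩ := (hS σ).1 hσ
      have e : F σ (w τ) = F τ (w τ) :=
        hagree τ hτc.1 σ h1.1 (aux_face_sub h2) hωτ _ hwτ.2.1
      simp only [E, LinearMap.sub_apply, e, map_smul, smul_eq_mul]
      module
    have e2 : F τ (y - b • w τ) = F ρ (y - b • w τ) :=
      hagree ρ hρ.1 τ hτc.1 (aux_face_sub hρτ) hω _ hb
    rw [map_sub, map_sub, map_smul, map_smul, smul_eq_mul, smul_eq_mul] at e2
    have : ((∑ σ ∈ S, C.wt σ ω * F σ (v τ σ)) - F τ y) • w τ - ∑ σ ∈ S, E τ σ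
        = (F τ - F ρ) (w τ) • (y - b • w τ) := by
      rw [hE, LinearMap.sub_apply]
      match_scalars
      · linear_combination (-1) * e2
      · ring
    simp only [hF]
    rw [this]
    exact Submodule.smul_mem _ _ hb
  have hsum := Submodule.sum_mem _ hper
  rw [Finset.sum_sub_distrib] at hsum
  suffices h : ∑ τ ∈ B.filter (fun τ => IsFaceOf ρ τ),
      ∑ σ ∈ A.filter (fun σ => IsFaceOf τ σ), E τ σ ∈ linSpan ρ by
    have := add_mem hsum h
    rwa [sub_add_cancel] at this
  rw [Finset.sum_comm' (t' := A)
    (s' := fun σ => B.filter fun τ => IsFaceOf ρ τ ∧ IsFaceOf τ σ)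
    (by intro τ σ; simp only [Finset.mem_filter]; tauto)]
  refine Submodule.sum_mem _ fun σ hσ => ?_
  have hσc := (hA σ).1 hσ
  simp only [E]
  rw [← Finset.smul_sum]
  refine Submodule.smul_mem _ _ ?_
  set S := B.filter fun τ => IsFaceOf ρ τ ∧ IsFaceOf τ σ with hSdef
  have hS : ∀ τ, τ ∈ S ↔ τ ∈ X.cells (k + 1) ∧ IsFaceOf ρ τ ∧ IsFaceOf τ σ := by
    intro τ; rw [hSdef, Finset.mem_filter, hB]
  rcases S.eq_empty_or_nonempty with h0 | ⟨τ0, h0⟩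
  · rw [h0]; simp
  obtain ⟨-, a0, b0⟩ := (hS τ0).1 h0
  have hρσ : ρ ⊆ σ := (aux_face_sub a0).trans (aux_face_sub b0)
  refine aux_sigma X hσc hρ S (fun τ => (hS τ).trans ?_) (fun τ => v τ σ) w ?_ ?_ (F σ - F ρ) ?_
  · constructor
    · rintro ⟨a, b, c⟩
      exact ⟨a, aux_face_sub b, aux_face_sub c⟩
    · rintro ⟨a, b, c⟩
      exact ⟨a, aux_sub_face X hρ.1 a.1 b, aux_sub_face X a.1 hσc.1 c⟩
  · intro τ hτ
    obtain ⟨a, b, c⟩ := (hS τ).1 hτ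
    exact hv τ a σ hσc c
  · intro τ hτ
    obtain ⟨a, b, c⟩ := (hS τ).1 hτ
    exact hw τ a b
  · intro y hy
    rw [LinearMap.sub_apply, hagree ρ hρ.1 σ hσc.1 hρσ hω y hy, sub_self]

/-- Proposition 1.11.  The corner locus `φ·C` of a piecewise smooth function `φ : |𝒞| → ℝ`
on a tropical cycle `C = (𝒞, m)` of dimension `n` with smooth weights is itself a tropical
cycle with smooth weights of dimension `n−1`: the subcomplex of `𝒞` generated by `𝒞_{n-1}`,
equipped with the corner-locus weight functions
`m_τ(ω) = Σ_{σ ≻ τ} m_σ(ω)·(∂φ_σ/∂ω_{σ,τ})(ω) − (∂φ_τ/∂ω_τ)(ω)`, has smooth weight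
functions and satisfies the balancing condition (in codimension one, i.e. along the cells
of `𝒞` of dimension `n−2`). -/
theorem corner_locus_is_tropical_cycle {r n : ℕ} (C : TropCycle r n)
    (φ : Pt r → ℝ) (hφ : PiecewiseSmoothWith C.cx φ)
    (v : Set (Pt r) → Set (Pt r) → Pt r)
    (hv : ∀ τ ∈ C.cx.cells (n - 1), ∀ σ ∈ C.cx.cells n,
      IsFaceOf τ σ → IsNormalGen σ τ (v τ σ))
    (g : Set (Pt r) → Pt r → ℝ)
    (hg : ∀ σ ∈ C.cx.faces, IsSmoothExtension σ φ (g σ)) :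
    (∀ τ ∈ C.cx.cells (n - 1), SmoothOnPoly τ (cornerWeight C v g τ)) ∧
      (∀ ρ ∈ C.cx.cells (n - 1 - 1), ∀ w : Set (Pt r) → Pt r,
        (∀ τ ∈ C.cx.cells (n - 1), IsFaceOf ρ τ → IsNormalGen τ ρ (w τ)) →
        ∀ ω ∈ ρ,
          (∑ᶠ τ ∈ { τ | τ ∈ C.cx.cells (n - 1) ∧ IsFaceOf ρ τ },
            cornerWeight C v g τ ω • w τ) ∈ linSpan ρ) := by
  classical
  refine ⟨fun τ hτ => ?_, ?_⟩
  · have hfin : { σ | σ ∈ C.cx.cells n ∧ IsFaceOf τ σ }.Finite :=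
      C.cx.finite.subset fun σ h => h.1.1
    have hS : ∀ σ, σ ∈ hfin.toFinset ↔ σ ∈ C.cx.cells n ∧ IsFaceOf τ σ :=
      fun σ => Set.Finite.mem_toFinset _
    refine aux_smooth_congr (f := fun ω =>
      (∑ σ ∈ hfin.toFinset, C.wt σ ω * fderiv ℝ (g σ) ω (v τ σ))
      - ∑ σ ∈ hfin.toFinset, C.wt σ ω * fderiv ℝ (g τ) ω (v τ σ)) ?_ ?_
    · refine aux_smooth_sub (aux_smooth_sum _ _ fun σ hσ => ?_)
        (aux_smooth_sum _ _ fun σ hσ => ?_)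
      · obtain ⟨a, b⟩ := (hS σ).1 hσ
        exact aux_smooth_mono (aux_face_sub b)
          (aux_smooth_mul (C.wt_smooth σ a) (aux_smooth_fderiv (hg σ a.1) _))
      · obtain ⟨a, b⟩ := (hS σ).1 hσ
        exact aux_smooth_mul (aux_smooth_mono (aux_face_sub b) (C.wt_smooth σ a))
          (aux_smooth_fderiv (hg τ hτ.1) _)
    · intro ω hω
      rw [aux_corner C φ v g hg hτ.1 _ hS hω, map_sum]
      simp only [map_smul, smul_eq_mul]
  · intro ρ hρ w hw ω hω
    match n, C, hv, hg, hρ, hw with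
    | 0, C, hv, hg, hρ, hw =>
      have := hw ρ hρ (Or.inl rfl)
      exact absurd this.2.1 this.2.2.1
    | 1, C, hv, hg, hρ, hw =>
      have := hw ρ hρ (Or.inl rfl)
      exact absurd this.2.1 this.2.2.1
    | k + 2, C, hv, hg, hρ, hw =>
      exact aux_main C φ v hv g hg ρ hρ w hw ω hω

end NonArchDelta
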